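/- arXiv:1702.04310 — 4 statements merged into one kernel-verified Lean document; each statement's English description precedes it below -/
import Mathlib

section
/- Let T > 0, n, m ∈ ℕ, X ⊆ ℝⁿ compact, U ⊆ ℝᵐ compact, and let F : [0,T] × ℝⁿ × ℝᵐ → ℝⁿ be a bounded Borel vector field. Suppose μ is a finite nonnegative Borel measure on [0,T] × X × U and σ, η are finite nonnegative Borel measures on [0,T] × X such that for every continuously differentiable v : [0,T] × ℝⁿ → ℝ one has ∫_{[0,T]×X×U} (∂_t v(t,x) + ∇_x v(t,x) · F(t,x,u)) dμ(t,x,u) + ∫_{[0,T]×X} v dσ = ∫_{[0,T]×X} v dη. Then the t-marginal of μ is absolutely continuous with respect to Lebesgue measure on [0,T]; consequently there exists a measurable family (μ̃_t)_{t∈[0,T]} of finite nonnegative Borel measures on X × U such that for every bounded Borel g : [0,T] × X × U → ℝ, ∫ g dμ = ∫₀ᵀ ∫_{X×U} g(t,x,u) dμ̃_t(x,u) dt. -/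
open MeasureTheory Set Filter Topology

/-- A finite measure on `ℝ` whose integrals of nonnegative continuous functions are bounded by a
multiple of their Lebesgue integral over `(0,T]` is absolutely continuous. -/
lemma ac_of_integral_le (ν : Measure ℝ) [IsFiniteMeasure ν] (T C : ℝ)
    (h : ∀ f : ℝ → ℝ, Continuous f → (∀ x, 0 ≤ f x) →
      ∫ x, f x ∂ν ≤ C * ∫ x in Ioc 0 T, f x) : ν ≪ volume := by
  have hclosed : ∀ K : Set ℝ, IsClosed K → volume K = 0 → ν K = 0 := by
    intro K hK h0
    have hpos : ∀ k : ℕ, (0:ℝ) < 1 / ((k:ℝ) + 1) := fun k => by positivity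
    have t1 := tendsto_integral_thickenedIndicator_of_isClosed ν hK hpos
      tendsto_one_div_add_atTop_nhds_zero_nat
    have t2 := tendsto_integral_thickenedIndicator_of_isClosed
      (volume.restrict (Ioc (0:ℝ) T)) hK hpos tendsto_one_div_add_atTop_nhds_zero_nat
    have hle := le_of_tendsto_of_tendsto' t1 (t2.const_mul C) (fun k => h _
      (NNReal.continuous_coe.comp (thickenedIndicator (hpos k) K).continuous)
      (fun x => NNReal.coe_nonneg _))
    have hz : (volume.restrict (Ioc (0:ℝ) T)).real K = 0 := by
      have : (volume.restrict (Ioc (0:ℝ) T)) K = 0 := Measure.absolutelyContinuous_of_le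
        Measure.restrict_le_self h0
      simp [Measure.real, this]
    rw [hz, mul_zero] at hle
    have : ν.real K = 0 := le_antisymm hle measureReal_nonneg
    rwa [measureReal_eq_zero_iff] at this
  refine Measure.AbsolutelyContinuous.mk fun s hs h0 => ?_
  by_contra hne
  obtain ⟨K, hKs, hK, hlt⟩ := hs.exists_lt_isClosed_of_ne_top (measure_ne_top ν s)
    (pos_iff_ne_zero.2 hne)
  exact hlt.ne' (hclosed K hK (measure_mono_null hKs h0))


open MeasureTheory Set

/-- If a finite nonnegative measure `μ` on `[0,T] × X × U`, together with
finite nonnegative measures `σ, η` on `[0,T] × X`, satisfies the (controlled) Liouville-type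
equation against all `C¹` test functions, then the `t`-marginal of `μ` is absolutely
continuous with respect to Lebesgue measure, and `μ` disintegrates as a measurable family
`(μ̃_t)` against Lebesgue measure on `[0,T]`. -/
theorem stmt0 {n m : ℕ} (T : ℝ) (hT : 0 < T)
    (X : Set (EuclideanSpace ℝ (Fin n))) (hX : IsCompact X)
    (U : Set (EuclideanSpace ℝ (Fin m))) (hU : IsCompact U)
    (F : ℝ × EuclideanSpace ℝ (Fin n) × EuclideanSpace ℝ (Fin m) → EuclideanSpace ℝ (Fin n))
    (hFmeas : Measurable F) (hFbdd : ∃ M : ℝ, ∀ p, ‖F p‖ ≤ M)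
    (μ : Measure (ℝ × EuclideanSpace ℝ (Fin n) × EuclideanSpace ℝ (Fin m)))
    [IsFiniteMeasure μ]
    (hμsupp : μ (Icc (0:ℝ) T ×ˢ X ×ˢ U)ᶜ = 0)
    (σ η : Measure (ℝ × EuclideanSpace ℝ (Fin n)))
    [IsFiniteMeasure σ] [IsFiniteMeasure η]
    (hσsupp : σ (Icc (0:ℝ) T ×ˢ X)ᶜ = 0) (hηsupp : η (Icc (0:ℝ) T ×ˢ X)ᶜ = 0)
    (heq : ∀ v : ℝ × EuclideanSpace ℝ (Fin n) → ℝ, ContDiff ℝ 1 v →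
      (∫ p, fderiv ℝ v (p.1, p.2.1) (1, F p) ∂μ) + (∫ p, v p ∂σ) = ∫ p, v p ∂η) :
    (μ.map Prod.fst) ≪ (volume : Measure ℝ) ∧
    ∃ μt : ℝ → Measure (EuclideanSpace ℝ (Fin n) × EuclideanSpace ℝ (Fin m)),
      (∀ t, IsFiniteMeasure (μt t)) ∧
      (∀ A : Set (EuclideanSpace ℝ (Fin n) × EuclideanSpace ℝ (Fin m)),
        MeasurableSet A → Measurable fun t => μt t A) ∧
      (∀ g : ℝ × EuclideanSpace ℝ (Fin n) × EuclideanSpace ℝ (Fin m) → ℝ,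
        Measurable g → (∃ C : ℝ, ∀ p, |g p| ≤ C) →
        ∫ p, g p ∂μ = ∫ t in Icc (0:ℝ) T, (∫ q, g (t, q) ∂(μt t))) := by
  classical
  have hfst : Measurable (Prod.fst : ℝ × EuclideanSpace ℝ (Fin n) × EuclideanSpace ℝ (Fin m) → ℝ) :=
    measurable_fst
  have key : ∀ f : ℝ → ℝ, Continuous f → (∀ x, 0 ≤ f x) →
      ∫ x, f x ∂(μ.map Prod.fst) ≤ η.real univ * ∫ x in Ioc 0 T, f x := by
    intro f hf hf0
    have hd : ∀ t, HasDerivAt (fun t => ∫ s in (0:ℝ)..t, f s) (f t) t := fun t =>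
      (hf.integral_hasStrictDerivAt 0 t).hasDerivAt
    have hdc : ContDiff ℝ 1 (fun t => ∫ s in (0:ℝ)..t, f s) := by
      rw [contDiff_one_iff_deriv]
      refine ⟨fun t => (hd t).differentiableAt, ?_⟩
      have : deriv (fun t => ∫ s in (0:ℝ)..t, f s) = f := funext fun t => (hd t).deriv
      rw [this]; exact hf
    have e := heq (fun p => ∫ s in (0:ℝ)..p.1, f s) (hdc.comp contDiff_fst)
    have hfd : ∀ p : ℝ × EuclideanSpace ℝ (Fin n) × EuclideanSpace ℝ (Fin m),
        fderiv ℝ (fun p : ℝ × EuclideanSpace ℝ (Fin n) => ∫ s in (0:ℝ)..p.1, f s)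
          (p.1, p.2.1) (1, F p) = f p.1 := by
      intro p
      have h1 := (hd p.1).hasFDerivAt.comp (p.1, p.2.1)
        (hasFDerivAt_fst (𝕜 := ℝ) (p := ((p.1, p.2.1) : ℝ × EuclideanSpace ℝ (Fin n))))
      have h2 := h1.fderiv
      simp only [Function.comp_def] at h2
      rw [h2]
      simp
    simp_rw [hfd] at e
    rw [integral_map hfst.aemeasurable hf.aestronglyMeasurable]
    have hσ0 : 0 ≤ ∫ p, (∫ s in (0:ℝ)..p.1, f s) ∂σ := by
      apply integral_nonneg_of_ae
      have : ∀ᵐ p ∂σ, p ∈ Icc (0:ℝ) T ×ˢ X := by rw [ae_iff]; exact hσsupp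
      filter_upwards [this] with p hp
      exact intervalIntegral.integral_nonneg hp.1.1 (fun x _ => hf0 x)
    have hηT : ∫ p, (∫ s in (0:ℝ)..p.1, f s) ∂η ≤ ∫ _p, (∫ s in (0:ℝ)..T, f s) ∂η := by
      have : ∀ᵐ p ∂η, p ∈ Icc (0:ℝ) T ×ˢ X := by rw [ae_iff]; exact hηsupp
      apply integral_mono_of_nonneg
      · filter_upwards [this] with p hp
        exact intervalIntegral.integral_nonneg hp.1.1 (fun x _ => hf0 x)
      · exact integrable_const _
      · filter_upwards [this] with p hp
        exact intervalIntegral.integral_mono_interval le_rfl hp.1.1 hp.1.2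
          (Filter.Eventually.of_forall hf0) (hf.intervalIntegrable _ _)
    rw [integral_const, smul_eq_mul, intervalIntegral.integral_of_le hT.le] at hηT
    linarith
  have hac : μ.map Prod.fst ≪ volume := ac_of_integral_le _ T _ key
  refine ⟨hac, ?_⟩
  set d : ℝ → NNReal := fun t => ((μ.map Prod.fst).rnDeriv volume t).toNNReal with hd
  have hdm : Measurable d := (Measure.measurable_rnDeriv _ _).ennreal_toNNReal
  have hdens : volume.withDensity (fun t => (d t : ENNReal)) = μ.map Prod.fst := by
    rw [← Measure.withDensity_rnDeriv_eq _ _ hac]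
    apply withDensity_congr_ae
    filter_upwards [Measure.rnDeriv_lt_top (μ.map Prod.fst) volume] with t ht
    simp [hd, ENNReal.coe_toNNReal ht.ne]
  refine ⟨fun t => d t • μ.condKernel t, fun t => inferInstance, fun A hA => ?_, ?_⟩
  · simp only [Measure.smul_apply]
    exact hdm.smul (μ.condKernel.measurable_coe hA)
  · rintro g hg ⟨C, hC⟩
    have hint : Integrable g (μ.fst.compProd μ.condKernel) :=
      Integrable.of_bound hg.aestronglyMeasurable C (Filter.Eventually.of_forall hC)
    have e1 : ∫ p, g p ∂μ = ∫ t, ∫ q, g (t, q) ∂(μ.condKernel t) ∂(μ.map Prod.fst) := by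
      conv_lhs => rw [← μ.disintegrate μ.condKernel]
      exact Measure.integral_compProd hint
    have hres : (μ.map Prod.fst).restrict (Icc 0 T) = μ.map Prod.fst := by
      apply Measure.restrict_eq_self_of_ae_mem
      rw [ae_iff]
      change (μ.map Prod.fst) (Icc 0 T)ᶜ = 0
      rw [Measure.map_apply hfst measurableSet_Icc.compl]
      refine measure_mono_null ?_ hμsupp
      intro p hp hp2
      exact hp hp2.1
    rw [e1, ← hres, ← hdens, setIntegral_withDensity_eq_setIntegral_smul hdm _ measurableSet_Icc]
    simp_rw [integral_smul_nnreal_measure]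
end

section
/- Let T > 0, n ∈ ℕ, X ⊆ ℝⁿ compact, and F̄ : [0,T] × ℝⁿ → ℝⁿ Borel. Suppose (μ_t, σ, η) satisfies the continuity equation driven by F̄ with source σ and sink η. Let Ψ : [0,T] × ℝⁿ → ℝⁿ be continuously differentiable and satisfy ∂_s Ψ(s,x) + D_x Ψ(s,x) · F̄(s,x) = 0 for all (s,x) ∈ [0,T] × X (Ψ plays the role of (s,x) ↦ Φ(T,s,x) for the flow Φ of F̄). Then for every continuously differentiable w : ℝⁿ → ℝ, ∫_{[0,T]×X} w(Ψ(s,x)) dσ(s,x) − ∫_{[0,T]×X} w(Ψ(s,x)) dη(s,x) = 0. -/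
open MeasureTheory Set

/-- `(μ_t, σ, η)` satisfies the continuity equation driven by `F` with source `σ` and
sink `η` on `[0,T]`: for every `C¹` test function `v`,
`∫₀ᵀ ∫ (∂ₜv + ∇ₓv · F) dμ_t dt + ∫ v dσ = ∫ v dη`. -/
def SatisfiesContinuityEq {n : ℕ} (T : ℝ)
    (F : ℝ → EuclideanSpace ℝ (Fin n) → EuclideanSpace ℝ (Fin n))
    (μ : ℝ → Measure (EuclideanSpace ℝ (Fin n)))
    (σ η : Measure (ℝ × EuclideanSpace ℝ (Fin n))) : Prop :=
  ∀ v : ℝ × EuclideanSpace ℝ (Fin n) → ℝ, ContDiff ℝ 1 v →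
    (∫ t in Icc (0:ℝ) T, ∫ x, fderiv ℝ v (t, x) (1, F t x) ∂(μ t))
      + (∫ p, v p ∂σ) = ∫ p, v p ∂η

/-- If `(μ_t, σ, η)` satisfies the continuity equation driven by `F̄`
and `Ψ` solves the backward transport equation `∂ₛΨ + DₓΨ · F̄ = 0` on `[0,T] × X`,
then `∫ w∘Ψ dσ − ∫ w∘Ψ dη = 0` for every `C¹` function `w`. -/
theorem stmt2 {n : ℕ} (T : ℝ) (hT : 0 < T)
    (X : Set (EuclideanSpace ℝ (Fin n))) (hX : IsCompact X)
    (F : ℝ → EuclideanSpace ℝ (Fin n) → EuclideanSpace ℝ (Fin n))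
    (hFmeas : Measurable fun p : ℝ × EuclideanSpace ℝ (Fin n) => F p.1 p.2)
    (μ : ℝ → Measure (EuclideanSpace ℝ (Fin n)))
    (hμfin : ∀ t, IsFiniteMeasure (μ t))
    (hμsupp : ∀ t, (μ t) Xᶜ = 0)
    (hμmeas : ∀ A : Set (EuclideanSpace ℝ (Fin n)), MeasurableSet A →
      Measurable fun t => μ t A)
    (σ η : Measure (ℝ × EuclideanSpace ℝ (Fin n)))
    [IsFiniteMeasure σ] [IsFiniteMeasure η]
    (hσsupp : σ (Icc (0:ℝ) T ×ˢ X)ᶜ = 0) (hηsupp : η (Icc (0:ℝ) T ×ˢ X)ᶜ = 0)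
    (hCE : SatisfiesContinuityEq T F μ σ η)
    (Ψ : ℝ × EuclideanSpace ℝ (Fin n) → EuclideanSpace ℝ (Fin n))
    (hΨ : ContDiff ℝ 1 Ψ)
    (hΨtransport : ∀ s ∈ Icc (0:ℝ) T, ∀ x ∈ X, fderiv ℝ Ψ (s, x) (1, F s x) = 0) :
    ∀ w : EuclideanSpace ℝ (Fin n) → ℝ, ContDiff ℝ 1 w →
      (∫ p, w (Ψ p) ∂σ) - (∫ p, w (Ψ p) ∂η) = 0 := by
  intro w hw
  have h := hCE (fun p => w (Ψ p)) (hw.comp hΨ)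
  have h0 : (∫ t in Icc (0:ℝ) T,
      ∫ x, fderiv ℝ (fun p => w (Ψ p)) (t, x) (1, F t x) ∂(μ t)) = 0 := by
    refine setIntegral_eq_zero_of_forall_eq_zero fun t ht => ?_
    refine integral_eq_zero_of_ae ?_
    have hX' : ∀ᵐ x ∂(μ t), x ∈ X := by
      rw [ae_iff]
      exact hμsupp t
    filter_upwards [hX'] with x hx
    have hc : fderiv ℝ (fun p => w (Ψ p)) (t, x)
        = (fderiv ℝ w (Ψ (t, x))).comp (fderiv ℝ Ψ (t, x)) :=
      fderiv_comp (t, x) (hw.differentiable one_ne_zero _) (hΨ.differentiable one_ne_zero _)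
    rw [hc, ContinuousLinearMap.comp_apply, hΨtransport t ht x hx, map_zero]
    rfl
  linarith
end

section
/- (Existence of a measurable feedback control via Radon–Nikodym differentiation.) Let T > 0, n, m ∈ ℕ, X ⊆ ℝⁿ compact, and U ⊆ ℝᵐ nonempty, compact, and convex. Let μ be a finite nonnegative Borel measure on [0,T] × X × U and let μ̄ denote its (t,x)-marginal, i.e. μ̄(A) = μ(A × U) for Borel A ⊆ [0,T] × X. Then there exists a Borel measurable function ũ : [0,T] × X → ℝᵐ such that ũ(t,x) ∈ U for μ̄-almost every (t,x), and for every j ∈ {1,…,m} and every Borel set A ⊆ [0,T] × X, ∫_A [ũ(t,x)]_j dμ̄(t,x) = ∫_{A×U} [u]_j dμ(t,x,u). -/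
open MeasureTheory Set

/-- existence of a measurable feedback control via Radon–Nikodym
differentiation. For a finite measure `μ` on `[0,T] × X × U` with `U` nonempty compact
convex, there is a Borel map `ũ : [0,T] × X → U` whose coordinates are the
Radon–Nikodym densities of the `u`-coordinate averages of `μ` with respect to its
`(t,x)`-marginal. -/
theorem stmt7 {n m : ℕ} (T : ℝ) (hT : 0 < T)
    (X : Set (EuclideanSpace ℝ (Fin n))) (hX : IsCompact X)
    (U : Set (EuclideanSpace ℝ (Fin m)))
    (hUne : U.Nonempty) (hUcomp : IsCompact U) (hUconv : Convex ℝ U)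
    (μ : Measure (ℝ × EuclideanSpace ℝ (Fin n) × EuclideanSpace ℝ (Fin m)))
    [IsFiniteMeasure μ]
    (hμsupp : μ (Icc (0:ℝ) T ×ˢ X ×ˢ U)ᶜ = 0) :
    ∃ u : ℝ × EuclideanSpace ℝ (Fin n) → EuclideanSpace ℝ (Fin m),
      Measurable u ∧
      (∀ᵐ p ∂(μ.map fun q : ℝ × EuclideanSpace ℝ (Fin n) × EuclideanSpace ℝ (Fin m) =>
        (q.1, q.2.1)), u p ∈ U) ∧
      ∀ j : Fin m, ∀ A : Set (ℝ × EuclideanSpace ℝ (Fin n)), MeasurableSet A →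
        (∫ p in A, u p j ∂(μ.map fun q : ℝ × EuclideanSpace ℝ (Fin n) ×
          EuclideanSpace ℝ (Fin m) => (q.1, q.2.1)))
        = ∫ q in (fun q : ℝ × EuclideanSpace ℝ (Fin n) × EuclideanSpace ℝ (Fin m) =>
            (q.1, q.2.1)) ⁻¹' A, q.2.2 j ∂μ := by
  set f : ℝ × EuclideanSpace ℝ (Fin n) × EuclideanSpace ℝ (Fin m) →
    ℝ × EuclideanSpace ℝ (Fin n) := fun q => (q.1, q.2.1) with hf
  set e : ℝ × EuclideanSpace ℝ (Fin n) × EuclideanSpace ℝ (Fin m) →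
    (ℝ × EuclideanSpace ℝ (Fin n)) × EuclideanSpace ℝ (Fin m) :=
    fun q => ((q.1, q.2.1), q.2.2) with he
  have hem : Measurable e := by fun_prop
  have hUm : MeasurableSet U := hUcomp.isClosed.measurableSet
  set ρ := μ.map e with hρ
  have hfst : μ.map f = ρ.fst := by
    rw [Measure.fst, hρ, Measure.map_map measurable_fst hem]
    rfl
  have hUae : ∀ᵐ q ∂ρ, q.2 ∈ U := by
    rw [hρ, ae_map_iff hem.aemeasurable (measurable_snd hUm)]
    have h0 : ∀ᵐ q ∂μ, q ∈ Icc (0:ℝ) T ×ˢ X ×ˢ U := hμsupp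
    filter_upwards [h0] with q hq using hq.2.2
  have hint : Integrable (fun q : (ℝ × EuclideanSpace ℝ (Fin n)) × EuclideanSpace ℝ (Fin m) => q.2) ρ := by
    obtain ⟨C, hC⟩ := hUcomp.isBounded.exists_norm_le
    refine Integrable.of_bound (by fun_prop) C ?_
    filter_upwards [hUae] with q hq using hC _ hq
  have hU2 : ∀ᵐ p ∂ρ.fst, ∀ᵐ v ∂ρ.condKernel p, v ∈ U := by
    have h1 : ∀ᵐ q ∂(ρ.fst.compProd ρ.condKernel), q.2 ∈ U := by
      rw [ρ.disintegrate ρ.condKernel]; exact hUae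
    exact Measure.ae_ae_of_ae_compProd h1
  have hi2 : ∀ᵐ p ∂ρ.fst, Integrable (fun v => v) (ρ.condKernel p) := hint.condKernel_ae
  rw [hfst]
  refine ⟨fun p => ∫ v, v ∂ρ.condKernel p, ?_, ?_, ?_⟩
  · exact (StronglyMeasurable.integral_kernel (κ := ρ.condKernel)
      (f := fun v => v) stronglyMeasurable_id).measurable
  · filter_upwards [hU2, hi2] with p h1 h2
    exact hUconv.integral_mem hUcomp.isClosed h1 h2
  · intro j A hA
    have hintj : Integrable (fun q : (ℝ × EuclideanSpace ℝ (Fin n)) × EuclideanSpace ℝ (Fin m) => q.2 j) ρ :=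
      (EuclideanSpace.proj j : EuclideanSpace ℝ (Fin m) →L[ℝ] ℝ).integrable_comp hint
    have h1 : ∫ p in A, (∫ v, v ∂ρ.condKernel p) j ∂ρ.fst
        = ∫ p in A, ∫ v, v j ∂ρ.condKernel p ∂ρ.fst := by
      apply integral_congr_ae
      filter_upwards [ae_restrict_of_ae hi2] with p h2
      exact ((EuclideanSpace.proj j : EuclideanSpace ℝ (Fin m) →L[ℝ] ℝ).integral_comp_comm h2).symm
    rw [h1, Measure.setIntegral_condKernel_univ_right (f := fun q : (ℝ × EuclideanSpace ℝ (Fin n)) × EuclideanSpace ℝ (Fin m) => q.2 j) hA hintj.integrableOn, hρ,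
      setIntegral_map (hA.prod MeasurableSet.univ) (hρ ▸ hintj.aestronglyMeasurable) hem.aemeasurable]
    congr 2
    ext q
    simp [he, hf]
end

section
/- (Mollification of the continuity equation.) Let T > 0, n ∈ ℕ, X ⊆ ℝⁿ compact, and let F̄ : [0,T] × ℝⁿ → ℝⁿ be Borel with |F̄(t,x)| ≤ M for all (t,x) and some finite M. Suppose (μ_t, σ, η) satisfies the continuity equation driven by F̄ with source σ and sink η. Let θ : ℝⁿ → ℝ be smooth, strictly positive, with ∫_{ℝⁿ} θ(y) dy = 1. Define: μ_t^θ as the measure on ℝⁿ with density x ↦ ∫ θ(x − y) dμ_t(y) with respect to Lebesgue measure; σ^θ and η^θ as the measures on [0,T] × ℝⁿ given by ∫ g dσ^θ = ∫_{[0,T]×X} ∫_{ℝⁿ} g(s, x + y) θ(y) dy dσ(s,x) and analogously for η^θ; and F̄^θ(t,x) := (∫ F̄(t,y) θ(x − y) dμ_t(y)) / (∫ θ(x − y) dμ_t(y)) when μ_t ≠ 0, and F̄^θ(t,x) := 0 when μ_t = 0. Then for every continuously differentiable, compactly supported v : [0,T] × ℝⁿ → ℝ, ∫₀ᵀ ∫_{ℝⁿ}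 (∂_t v(t,x) + ∇_x v(t,x) · F̄^θ(t,x)) dμ_t^θ(x) dt + ∫ v dσ^θ = ∫ v dη^θ; moreover |F̄^θ(t,x)| ≤ M for all (t,x). -/
open MeasureTheory Set

/-- Spatial mollification of the family `(μ_t)` by the kernel `θ`: the measure with
density `x ↦ ∫ θ(x − y) dμ_t(y)` with respect to the Lebesgue measure. -/
noncomputable def mollifiedFamily {n : ℕ} (θ : EuclideanSpace ℝ (Fin n) → ℝ)
    (μ : ℝ → Measure (EuclideanSpace ℝ (Fin n))) (t : ℝ) :
    Measure (EuclideanSpace ℝ (Fin n)) :=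
  volume.withDensity fun x => ENNReal.ofReal (∫ y, θ (x - y) ∂(μ t))

/-- Spatial mollification of a measure on `[0,T] × ℝⁿ` by the kernel `θ`: it satisfies
`∫ g dσᶿ = ∫∫ g(s, x + y) θ(y) dy dσ(s,x)`. -/
noncomputable def mollifiedMeasure {n : ℕ} (θ : EuclideanSpace ℝ (Fin n) → ℝ)
    (σ : Measure (ℝ × EuclideanSpace ℝ (Fin n))) :
    Measure (ℝ × EuclideanSpace ℝ (Fin n)) :=
  Measure.map (fun q : (ℝ × EuclideanSpace ℝ (Fin n)) × EuclideanSpace ℝ (Fin n) =>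
      (q.1.1, q.1.2 + q.2))
    (σ.prod (volume.withDensity fun y => ENNReal.ofReal (θ y)))

/-- Mollification of the vector field `F̄` by the kernel `θ` relative to the family
`(μ_t)`: `F̄ᶿ(t,x) = (∫ θ(x−y) F̄(t,y) dμ_t(y)) / (∫ θ(x−y) dμ_t(y))` when `μ_t ≠ 0`,
and `0` otherwise. -/
noncomputable def mollifiedField {n : ℕ} (θ : EuclideanSpace ℝ (Fin n) → ℝ)
    (μ : ℝ → Measure (EuclideanSpace ℝ (Fin n)))
    (F : ℝ → EuclideanSpace ℝ (Fin n) → EuclideanSpace ℝ (Fin n))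
    (t : ℝ) (x : EuclideanSpace ℝ (Fin n)) : EuclideanSpace ℝ (Fin n) :=
  open scoped Classical in
  if μ t = 0 then 0
  else (∫ y, θ (x - y) ∂(μ t))⁻¹ • ∫ y, θ (x - y) • F t y ∂(μ t)


section helpers

variable {n : ℕ}

local notation "E" => EuclideanSpace ℝ (Fin n)

lemma mol_integrable_theta (θ : E → ℝ) (hθmass : ∫ y, θ y = 1) : Integrable θ := by
  by_contra h
  rw [integral_undef h] at hθmass
  exact zero_ne_one hθmass

lemma mol_finite (θ : E → ℝ) (hi : Integrable θ) :
    IsFiniteMeasure ((volume : Measure E).withDensity fun y => ENNReal.ofReal (θ y)) :=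
  isFiniteMeasure_withDensity_ofReal hi.2

lemma mol_int_kernel (X : Set E) (hX : IsCompact X) (m : Measure E) [IsFiniteMeasure m]
    (hm : m Xᶜ = 0) (θ : E → ℝ) (hc : Continuous θ) (x : E) :
    Integrable (fun y => θ (x - y)) m := by
  have h1 : IntegrableOn (fun y => θ (x - y)) X m :=
    (hc.comp (continuous_const.sub continuous_id)).continuousOn.integrableOn_compact hX
  have h2 : m.restrict X = m := by
    apply Measure.restrict_eq_self_of_ae_mem
    exact hm
  rwa [IntegrableOn, h2] at h1

lemma mol_integral_nu (θ : E → ℝ) (hc : Continuous θ) (hpos : ∀ y, 0 < θ y)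
    {H : Type*} [NormedAddCommGroup H] [NormedSpace ℝ H] (g : E → H) :
    ∫ z, g z ∂((volume : Measure E).withDensity fun y => ENNReal.ofReal (θ y))
      = ∫ z, θ z • g z := by
  rw [integral_withDensity_eq_integral_toReal_smul
    (hc.measurable.ennreal_ofReal) (by simp)]
  simp [ENNReal.toReal_ofReal (hpos _).le]

lemma mol_w (ν : Measure E) [IsFiniteMeasure ν] (v : ℝ × E → ℝ) (hv : ContDiff ℝ 1 v)
    (hs : HasCompactSupport v) :
    ContDiff ℝ 1 (fun p : ℝ × E => ∫ z, v (p.1, p.2 + z) ∂ν) ∧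
    ∀ p : ℝ × E, fderiv ℝ (fun p : ℝ × E => ∫ z, v (p.1, p.2 + z) ∂ν) p
      = ∫ z, fderiv ℝ v (p.1, p.2 + z) ∂ν := by
  have hDc : Continuous (fderiv ℝ v) := hv.continuous_fderiv one_ne_zero
  obtain ⟨C, hC⟩ := (hs.fderiv (𝕜 := ℝ)).exists_bound_of_continuous hDc
  obtain ⟨B, hB⟩ := hs.exists_bound_of_continuous hv.continuous
  have key : ∀ p : ℝ × E, HasFDerivAt (fun p : ℝ × E => ∫ z, v (p.1, p.2 + z) ∂ν)
      (∫ z, fderiv ℝ v (p.1, p.2 + z) ∂ν) p := by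
    intro p
    refine hasFDerivAt_integral_of_dominated_of_fderiv_le (bound := fun _ => C)
      (F' := fun p z => fderiv ℝ v (p.1, p.2 + z)) (s := univ) Filter.univ_mem ?_ ?_ ?_ ?_ ?_ ?_
    · refine Filter.Eventually.of_forall fun q => ?_
      exact (hv.continuous.comp (by fun_prop)).aestronglyMeasurable
    · refine Integrable.of_bound (C := B) ?_ ?_
      · exact (hv.continuous.comp (by fun_prop)).aestronglyMeasurable
      · exact Filter.Eventually.of_forall fun z => hB _
    · exact (hDc.comp (by fun_prop)).aestronglyMeasurable
    · exact Filter.Eventually.of_forall fun z q _ => hC _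
    · exact integrable_const _
    · refine Filter.Eventually.of_forall fun z q _ => ?_
      have h1 : HasFDerivAt v (fderiv ℝ v (q + (0, z))) (q + (0, z)) :=
        ((hv.differentiable one_ne_zero) _).hasFDerivAt
      have h2 : HasFDerivAt (fun r : ℝ × E => v (r + (0, z))) (fderiv ℝ v (q + (0, z))) q :=
        (hasFDerivAt_comp_add_right (0, z)).2 h1
      have e : ∀ r : ℝ × E, r + (0, z) = (r.1, r.2 + z) := fun r => by ext <;> simp
      simpa only [e] using h2
  have hf : ∀ p : ℝ × E, fderiv ℝ (fun p : ℝ × E => ∫ z, v (p.1, p.2 + z) ∂ν) p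
      = ∫ z, fderiv ℝ v (p.1, p.2 + z) ∂ν := fun p => (key p).fderiv
  refine ⟨contDiff_one_iff_fderiv.2 ⟨fun p => (key p).differentiableAt, ?_⟩, hf⟩
  rw [funext hf]
  refine continuous_of_dominated (bound := fun _ => C) ?_ ?_ (integrable_const _) ?_
  · exact fun p => (hDc.comp (by fun_prop)).aestronglyMeasurable
  · exact fun p => Filter.Eventually.of_forall fun z => hC _
  · exact Filter.Eventually.of_forall fun z => hDc.comp (by fun_prop)

lemma mol_measure (θ : E → ℝ) (hi : Integrable θ) (σ : Measure (ℝ × E)) [IsFiniteMeasure σ]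
    (v : ℝ × E → ℝ) (hv : Continuous v) (hs : HasCompactSupport v) :
    ∫ p, v p ∂(mollifiedMeasure θ σ) = ∫ p, (∫ z, v (p.1, p.2 + z)
      ∂((volume : Measure E).withDensity fun y => ENNReal.ofReal (θ y))) ∂σ := by
  have := mol_finite θ hi
  obtain ⟨B, hB⟩ := hs.exists_bound_of_continuous hv
  unfold mollifiedMeasure
  rw [integral_map (by fun_prop) hv.aestronglyMeasurable, integral_prod]
  refine Integrable.of_bound (C := B) ?_ (Filter.Eventually.of_forall fun z => hB _)
  exact (hv.comp (by fun_prop)).aestronglyMeasurable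

lemma mol_prod_int (m : Measure E) [IsFiniteMeasure m] (θ : E → ℝ) (hc : Continuous θ)
    (hi : Integrable θ) :
    Integrable (fun q : E × E => θ (q.1 - q.2)) ((volume : Measure E).prod m) := by
  have hcc : Continuous (fun q : E × E => θ (q.1 - q.2)) := hc.comp (by fun_prop)
  rw [integrable_prod_iff' hcc.aestronglyMeasurable]
  refine ⟨Filter.Eventually.of_forall fun y => hi.comp_sub_right y, ?_⟩
  have : (fun y : E => ∫ x, ‖θ (x - y)‖) = fun _ => ∫ x, ‖θ x‖ := by
    funext y
    exact integral_sub_right_eq_self (fun x => ‖θ x‖) y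
  simp only [this]
  exact integrable_const _

lemma mol_slice (X : Set E) (hX : IsCompact X) (m : Measure E) [IsFiniteMeasure m]
    (hm : m Xᶜ = 0) (hm0 : m ≠ 0) (θ : E → ℝ) (hc : Continuous θ) (hpos : ∀ y, 0 < θ y)
    (hi : Integrable θ) (f : E → E) (hf : Measurable f) (M : ℝ) (hM : ∀ x, ‖f x‖ ≤ M)
    (G : E → (ℝ × E →L[ℝ] ℝ)) (hG : Continuous G) (C : ℝ) (hC : ∀ x, ‖G x‖ ≤ C) :
    ∫ x, G x (1, (∫ y, θ (x - y) ∂m)⁻¹ • ∫ y, θ (x - y) • f y ∂m)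
      ∂((volume : Measure E).withDensity fun x => ENNReal.ofReal (∫ y, θ (x - y) ∂m))
    = ∫ y, (∫ z, G (y + z) ∂((volume : Measure E).withDensity fun y => ENNReal.ofReal (θ y)))
        (1, f y) ∂m := by
  have := mol_finite θ hi
  have hk := mol_int_kernel X hX m hm θ hc
  have hρpos : ∀ x, 0 < ∫ y, θ (x - y) ∂m := by
    intro x
    rw [integral_pos_iff_support_of_nonneg (fun y => (hpos _).le) (hk x)]
    have : Function.support (fun y => θ (x - y)) = univ := by
      ext y; simp [(hpos _).ne']
    rw [this]
    simpa [pos_iff_ne_zero] using hm0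
  have hρmeas : Measurable fun x => ∫ y, θ (x - y) ∂m := by
    have : StronglyMeasurable (fun q : E × E => θ (q.1 - q.2)) :=
      (hc.comp (by fun_prop)).stronglyMeasurable
    exact this.integral_prod_right.measurable
  have hkf : ∀ x, Integrable (fun y => θ (x - y) • f y) m := by
    intro x
    refine (hk x).smul_bdd M hf.aestronglyMeasurable ?_
    exact Filter.Eventually.of_forall hM
  have hone : ∀ y, ‖((1 : ℝ), f y)‖ ≤ max 1 M := by
    intro y
    rw [Prod.norm_mk]
    exact max_le_max (by simp) (hM y)
  have hC0 : 0 ≤ C := (norm_nonneg _).trans (hC 0)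
  have hfm : Measurable fun y => ((1 : ℝ), f y) := measurable_const.prodMk hf
  rw [integral_withDensity_eq_integral_toReal_smul hρmeas.ennreal_ofReal (by simp)]
  have e1 : ∀ x, (ENNReal.ofReal (∫ y, θ (x - y) ∂m)).toReal •
      G x (1, (∫ y, θ (x - y) ∂m)⁻¹ • ∫ y, θ (x - y) • f y ∂m)
      = ∫ y, θ (x - y) • G x (1, f y) ∂m := by
    intro x
    rw [ENNReal.toReal_ofReal (hρpos x).le, ← map_smul, Prod.smul_mk,
      smul_inv_smul₀ (hρpos x).ne']
    have h2 : Integrable (fun y => θ (x - y) • ((1 : ℝ), f y)) m := by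
      refine (hk x).smul_bdd (max 1 M) hfm.aestronglyMeasurable ?_
      exact Filter.Eventually.of_forall hone
    have h3 := (G x).integral_comp_comm h2
    simp only [map_smul] at h3
    rw [h3]
    congr 1
    have h4 : ∀ y, θ (x - y) • ((1 : ℝ), f y) = (θ (x - y), θ (x - y) • f y) := by
      intro y; simp [Prod.smul_mk]
    simp only [h4]
    rw [integral_pair (hk x) (hkf x)]
    simp
  simp only [e1]
  rw [integral_integral_swap]
  · refine integral_congr_ae (Filter.Eventually.of_forall fun y => ?_)
    have hGi : Integrable (fun z => G (y + z))
        ((volume : Measure E).withDensity fun y => ENNReal.ofReal (θ y)) :=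
      Integrable.of_bound (C := C) (hG.comp (by fun_prop)).aestronglyMeasurable
        (Filter.Eventually.of_forall fun z => hC _)
    dsimp only
    rw [ContinuousLinearMap.integral_apply hGi, mol_integral_nu θ hc hpos,
      ← integral_sub_right_eq_self (fun z => θ z • (G (y + z)) (1, f y)) y]
    simp
  · refine (mol_prod_int m θ hc hi).smul_bdd (C * max 1 M) (β := ℝ)
      (f := fun q : E × E => G q.1 (1, f q.2)) ?_ ?_
    · have a : Measurable fun q : E × E => G q.1 := hG.measurable.comp measurable_fst
      have b : Measurable fun q : E × E => ((1 : ℝ), f q.2) := hfm.comp measurable_snd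
      have c : Continuous fun r : (ℝ × E →L[ℝ] ℝ) × (ℝ × E) => r.1 r.2 := by fun_prop
      exact (c.measurable.comp (a.prodMk b)).aestronglyMeasurable
    · refine Filter.Eventually.of_forall fun q => ?_
      exact ((G q.1).le_opNorm _).trans (mul_le_mul (hC _) (hone _) (norm_nonneg _) hC0)

end helpers

/-- mollification of the continuity equation. The mollified triple
`(μ_tᶿ, σᶿ, ηᶿ)` satisfies the continuity equation driven by the mollified field `F̄ᶿ`
(against compactly supported `C¹` test functions), and `F̄ᶿ` obeys the same bound `M`. -/
theorem stmt13 {n : ℕ} (T : ℝ) (hT : 0 < T)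
    (X : Set (EuclideanSpace ℝ (Fin n))) (hX : IsCompact X)
    (F : ℝ → EuclideanSpace ℝ (Fin n) → EuclideanSpace ℝ (Fin n))
    (hFmeas : Measurable fun p : ℝ × EuclideanSpace ℝ (Fin n) => F p.1 p.2)
    (M : ℝ) (hFbdd : ∀ t x, ‖F t x‖ ≤ M)
    (μ : ℝ → Measure (EuclideanSpace ℝ (Fin n)))
    (hμfin : ∀ t, IsFiniteMeasure (μ t))
    (hμsupp : ∀ t, (μ t) Xᶜ = 0)
    (hμmeas : ∀ A : Set (EuclideanSpace ℝ (Fin n)), MeasurableSet A →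
      Measurable fun t => μ t A)
    (σ η : Measure (ℝ × EuclideanSpace ℝ (Fin n)))
    [IsFiniteMeasure σ] [IsFiniteMeasure η]
    (hσsupp : σ (Icc (0:ℝ) T ×ˢ X)ᶜ = 0) (hηsupp : η (Icc (0:ℝ) T ×ˢ X)ᶜ = 0)
    (hCE : SatisfiesContinuityEq T F μ σ η)
    (θ : EuclideanSpace ℝ (Fin n) → ℝ)
    (hθsmooth : ContDiff ℝ (⊤ : ℕ∞) θ) (hθpos : ∀ y, 0 < θ y)
    (hθmass : ∫ y, θ y = 1) :
    (∀ v : ℝ × EuclideanSpace ℝ (Fin n) → ℝ, ContDiff ℝ 1 v → HasCompactSupport v →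
      (∫ t in Icc (0:ℝ) T,
          ∫ x, fderiv ℝ v (t, x) (1, mollifiedField θ μ F t x) ∂(mollifiedFamily θ μ t))
        + (∫ p, v p ∂(mollifiedMeasure θ σ)) = ∫ p, v p ∂(mollifiedMeasure θ η)) ∧
    ∀ t x, ‖mollifiedField θ μ F t x‖ ≤ M := by
  have hc : Continuous θ := hθsmooth.continuous
  have hi := mol_integrable_theta θ hθmass
  have := mol_finite θ hi
  constructor
  · intro v hv hs
    obtain ⟨hw, hw'⟩ := mol_w (volume.withDensity fun y => ENNReal.ofReal (θ y)) v hv hs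
    rw [mol_measure θ hi σ v hv.continuous hs, mol_measure θ hi η v hv.continuous hs,
      ← hCE _ hw]
    congr 2
    funext t
    have := hμfin t
    have hDc : Continuous (fderiv ℝ v) := hv.continuous_fderiv one_ne_zero
    obtain ⟨C, hC⟩ := (hs.fderiv (𝕜 := ℝ)).exists_bound_of_continuous hDc
    by_cases h0 : μ t = 0
    · simp [mollifiedFamily, h0]
    · simp only [hw', mollifiedField, mollifiedFamily, if_neg h0]
      exact mol_slice X hX (μ t) (hμsupp t) h0 θ hc hθpos hi (F t)
        (hFmeas.comp measurable_prodMk_left) M (hFbdd t) (fun x => fderiv ℝ v (t, x))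
        (hDc.comp (by fun_prop)) C (fun x => hC _)
  · intro t x
    have hM0 : 0 ≤ M := (norm_nonneg _).trans (hFbdd t x)
    have := hμfin t
    by_cases h0 : μ t = 0
    · simpa [mollifiedField, h0] using hM0
    · simp only [mollifiedField, if_neg h0]
      have hk := mol_int_kernel X hX (μ t) (hμsupp t) θ hc x
      have hρ : 0 ≤ ∫ y, θ (x - y) ∂(μ t) := integral_nonneg fun y => (hθpos _).le
      have h1 : ‖∫ y, θ (x - y) • F t y ∂(μ t)‖ ≤ ∫ y, θ (x - y) * M ∂(μ t) := by
        refine norm_integral_le_of_norm_le (hk.mul_const M)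
          (Filter.Eventually.of_forall fun y => ?_)
        rw [norm_smul, Real.norm_of_nonneg (hθpos _).le]
        exact mul_le_mul_of_nonneg_left (hFbdd t y) (hθpos _).le
      rw [integral_mul_const] at h1
      rw [norm_smul, norm_inv, Real.norm_of_nonneg hρ]
      calc _ ≤ (∫ y, θ (x - y) ∂(μ t))⁻¹ * ((∫ y, θ (x - y) ∂(μ t)) * M) :=
            mul_le_mul_of_nonneg_left h1 (inv_nonneg.2 hρ)
        _ ≤ M := by
            rw [← mul_assoc]
            exact mul_le_of_le_one_left hM0 (inv_mul_le_one)
end
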